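/- For every l ≥ 1 and every even matrix Q ∈ End(V): 𝒟_{l,Q}(u, ∂_u) = Σ_{k=0}^{l} (−1)^k binom(𝒩 − k, l − k) 𝒯_{k,Q}(u) e^{−k∂_u}, where 𝒩 = m − n and binom(x, r) = x(x−1)⋯(x−r+1)/r! is the generalized binomial coefficient. -/

import Mathlib

noncomputable section
namespace Paper

def parN (m : ℕ) (c : ℕ) : ℕ := if c < m then 0 else 1
def par (m : ℕ) {N : ℕ} (a : Fin N) : ℕ := parN m a

section Super
variable {R : Type} [Ring R] [Algebra ℂ R] {ι : Type} [Fintype ι] [DecidableEq ι] {N : ℕ}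

def mpar (m : ℕ) (r : ι → Fin N) : ℕ := ∑ v, par m (r v)

def sMul (m : ℕ) (A B : Matrix (ι → Fin N) (ι → Fin N) R) :
    Matrix (ι → Fin N) (ι → Fin N) R := fun r t =>
  ∑ s : ι → Fin N, ((-1 : R) ^ ((mpar m s + mpar m t) * (mpar m r + mpar m s))) * A r s * B s t

def invExp (m : ℕ) (lt : ι → ι → Prop) [DecidableRel lt] (σ : Equiv.Perm ι)
    (s : ι → Fin N) : ℕ :=
  ∑ p ∈ Finset.univ.filter (fun p : ι × ι => lt p.1 p.2 ∧ lt (σ p.2) (σ p.1)),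
    par m (s p.1) * par m (s p.2)

def permMat (m : ℕ) (lt : ι → ι → Prop) [DecidableRel lt] (σ : Equiv.Perm ι) :
    Matrix (ι → Fin N) (ι → Fin N) R := fun r s =>
  if r = s ∘ σ.symm then (-1 : R) ^ invExp m lt σ s else 0

def embed (m : ℕ) (lt : ι → ι → Prop) [DecidableRel lt] (v : ι) (f : Fin N → Fin N → R) :
    Matrix (ι → Fin N) (ι → Fin N) R := fun r s =>
  if ∀ w, w ≠ v → r w = s w then
    ((-1 : R) ^ ((par m (r v) + par m (s v)) *
        ∑ w ∈ Finset.univ.filter (fun w => lt w v), par m (s w))) * f (r v) (s v)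
  else 0

def strace (m : ℕ) (M : Matrix (ι → Fin N) (ι → Fin N) R) : R :=
  ∑ r : ι → Fin N, (-1 : R) ^ mpar m r * M r r

def shiftCoeff (z : ℂ) (p s : ℕ) : ℂ := ((p - 1).choose (p - s) : ℂ) * z ^ (p - s)

def serMul (m : ℕ) (F G : ℕ → Matrix (ι → Fin N) (ι → Fin N) R) :
    ℕ → Matrix (ι → Fin N) (ι → Fin N) R :=
  fun p => ∑ q ∈ Finset.range (p + 1), sMul m (F q) (G (p - q))

def serOne : ℕ → Matrix (ι → Fin N) (ι → Fin N) R := fun p => if p = 0 then 1 else 0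

def serProd (m : ℕ) (l : List (ℕ → Matrix (ι → Fin N) (ι → Fin N) R)) :
    ℕ → Matrix (ι → Fin N) (ι → Fin N) R := l.foldl (serMul m) serOne

def kron (Q : Matrix (Fin N) (Fin N) ℂ) : Matrix (ι → Fin N) (ι → Fin N) ℂ :=
  fun r s => ∏ v, Q (r v) (s v)

end Super

def symmZ (m : ℕ) (N k : ℕ) : Matrix (Fin k → Fin N) (Fin k → Fin N) ℂ :=
  ((k.factorial : ℂ))⁻¹ • ∑ σ : Equiv.Perm (Fin k), permMat m (· < ·) σ

def asymmZ (m : ℕ) (N k : ℕ) : Matrix (Fin k → Fin N) (Fin k → Fin N) ℂ :=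
  ((k.factorial : ℂ))⁻¹ •
    ∑ σ : Equiv.Perm (Fin k), (((Equiv.Perm.sign σ : ℤ) : ℂ)) • permMat m (· < ·) σ

/- ----------------  The super Yangian  ---------------- -/

abbrev YGen (N : ℕ) := Fin N × Fin N × ℕ

def Tfree {N : ℕ} (a b : Fin N) : ℕ → FreeAlgebra ℂ (YGen N)
  | 0 => if a = b then 1 else 0
  | s + 1 => FreeAlgebra.ι ℂ (a, b, s)

inductive YRel (m n : ℕ) :
    FreeAlgebra ℂ (YGen (m + n)) → FreeAlgebra ℂ (YGen (m + n)) → Prop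
  | rtt (a b c d : Fin (m + n)) (r s : ℕ) :
      YRel m n
        ((Tfree a b (r + 1) * Tfree c d s -
            ((-1 : ℂ) ^ ((par m a + par m b) * (par m c + par m d))) •
              (Tfree c d s * Tfree a b (r + 1)))
          - (Tfree a b r * Tfree c d (s + 1) -
            ((-1 : ℂ) ^ ((par m a + par m b) * (par m c + par m d))) •
              (Tfree c d (s + 1) * Tfree a b r)))
        (((-1 : ℂ) ^ (par m a * par m c + par m a * par m d + par m c * par m d)) •
          (Tfree c b s * Tfree a d r - Tfree c b r * Tfree a d s))

abbrev Yangian (m n : ℕ) := RingQuot (YRel m n)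

def TT (m n : ℕ) (a b : Fin (m + n)) (s : ℕ) : Yangian m n :=
  RingQuot.mkAlgHom ℂ (YRel m n) (Tfree a b s)

/-- The series `T^{(v, ι∪{∗})}(u - z)` as a matrix power series over the Yangian. -/
def TfacY (m n : ℕ) {ι : Type} [Fintype ι] [DecidableEq ι]
    (lt : ι → ι → Prop) [DecidableRel lt] (v : ι) (z : ℂ) :
    ℕ → Matrix (ι → Fin (m + n)) (ι → Fin (m + n)) (Yangian m n) :=
  fun p => embed m lt v
    (fun a b => ∑ s ∈ Finset.range (p + 1),
      algebraMap ℂ (Yangian m n) (shiftCoeff z p s) * TT m n a b s)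

/-- The series `T^{(k,k+1)}(u) ⋯ T^{(1,k+1)}(u-k+1)` on `V^{⊗k}` (Yangian in the last slot). -/
def TwedgeProd (m n k : ℕ) :
    ℕ → Matrix (Fin k → Fin (m + n)) (Fin k → Fin (m + n)) (Yangian m n) :=
  serProd m (((List.finRange k).reverse).map fun i =>
    TfacY m n (· < ·) i ((k : ℂ) - 1 - (i : ℕ)))

/-- The series `T^{(1,k+1)}(u) ⋯ T^{(k,k+1)}(u-k+1)` on `V^{⊗k}`. -/
def TsymProd (m n k : ℕ) :
    ℕ → Matrix (Fin k → Fin (m + n)) (Fin k → Fin (m + n)) (Yangian m n) :=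
  serProd m ((List.finRange k).map fun i => TfacY m n (· < ·) i ((i : ℕ) : ℂ))

/-- Coefficients of the transfer matrix `𝒯_{k,Q}(u) = str_{V^{∧k}}(Q^{∧k} T^{∧k}(u))`. -/
def transferT (m n k : ℕ) (Q : Matrix (Fin (m + n)) (Fin (m + n)) ℂ) : ℕ → Yangian m n :=
  fun p => if k = 0 then (if p = 0 then 1 else 0) else
    strace m (sMul m ((asymmZ m (m + n) k).map (algebraMap ℂ (Yangian m n)))
      (sMul m ((kron (ι := Fin k) Q).map (algebraMap ℂ (Yangian m n))) (TwedgeProd m n k p)))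

/-- Shift `F(u) ↦ F(u-z)` of a matrix power series in `u^{-1}`. -/
def serShift {ι : Type} [Fintype ι] [DecidableEq ι] {N : ℕ} {R : Type} [Ring R] [Algebra ℂ R]
    (z : ℂ) (F : ℕ → Matrix (ι → Fin N) (ι → Fin N) R) :
    ℕ → Matrix (ι → Fin N) (ι → Fin N) R :=
  fun p => ∑ s ∈ Finset.range (p + 1), shiftCoeff z p s • F s

/-- Generalized binomial coefficient `binom(x, r) = x(x-1)⋯(x-r+1)/r!`. -/
def zbinom (x : ℂ) (r : ℕ) : ℂ := (∏ i ∈ Finset.range r, (x - (i : ℕ))) / (r.factorial : ℂ)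

/-- Product of difference operators `Σ_k F_k(u) e^{-k∂_u}` with matrix series coefficients. -/
def dopMulM (m : ℕ) {ι : Type} [Fintype ι] [DecidableEq ι] {N : ℕ} {R : Type} [Ring R]
    [Algebra ℂ R] (F G : ℕ → ℕ → Matrix (ι → Fin N) (ι → Fin N) R) :
    ℕ → ℕ → Matrix (ι → Fin N) (ι → Fin N) R :=
  fun k p => ∑ i ∈ Finset.range (k + 1), serMul m (F i) (serShift (i : ℂ) (G (k - i))) p

def dopOneM {ι : Type} [Fintype ι] [DecidableEq ι] {N : ℕ} {R : Type} [Ring R] :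
    ℕ → ℕ → Matrix (ι → Fin N) (ι → Fin N) R :=
  fun k p => if k = 0 ∧ p = 0 then 1 else 0

/-- The `i`-th factor `1 - Q^{(i)} T^{(i,l+1)}(u) e^{-∂_u}` of `𝒟_{l,Q}(u,∂_u)`. -/
def DlFactor (m n l : ℕ) (Q : Matrix (Fin (m + n)) (Fin (m + n)) ℂ) (i : Fin l) :
    ℕ → ℕ → Matrix (Fin l → Fin (m + n)) (Fin l → Fin (m + n)) (Yangian m n) :=
  fun k => if k = 0 then serOne else if k = 1 then
    (fun p => -(sMul m ((embed m (· < ·) i (fun a b => Q a b)).map (algebraMap ℂ (Yangian m n)))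
      (TfacY m n (· < ·) i 0 p)))
  else fun _ => 0

/-- The coefficients (at `e^{-k∂_u} u^{-p}`) of the difference operator
`𝒟_{l,Q}(u,∂_u) = (str ⊗ id)((→∏_{1≤i≤l} (1 - Q^{(i)} T^{(i,l+1)}(u) e^{-∂_u})) A_l)`. -/
def DlQ (m n l : ℕ) (Q : Matrix (Fin (m + n)) (Fin (m + n)) ℂ) : ℕ → ℕ → Yangian m n :=
  fun k p =>
    strace m (sMul m
      ((((List.finRange l).map (DlFactor m n l Q)).foldl (dopMulM m) dopOneM) k p)
      ((asymmZ m (m + n) l).map (algebraMap ℂ (Yangian m n))))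

section Signs

variable {R : Type} [Ring R]

theorem neg_one_pow_eq_of_zmod {a b : ℕ} (h : (a : ZMod 2) = b) : (-1 : R) ^ a = (-1) ^ b := by
  have h2 : a % 2 = b % 2 := (ZMod.natCast_eq_natCast_iff' a b 2).1 h
  rw [neg_one_pow_eq_pow_mod_two, h2, ← neg_one_pow_eq_pow_mod_two]

theorem neg_one_pow_mul_mul (a b : ℕ) (x y : R) :
    ((-1 : R) ^ a * x) * ((-1) ^ b * y) = (-1) ^ (a + b) * (x * y) := by
  rw [pow_add, mul_assoc, ← mul_assoc x, ← ((Commute.neg_one_left x).pow_left b).eq]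
  simp only [mul_assoc]

end Signs

section Twist

variable {R : Type} [Ring R] {ι : Type} [Fintype ι] {N : ℕ}

/-- The sign twist turning the supermatrix product `sMul` into the ordinary matrix product. -/
def twist (m : ℕ) (A : Matrix (ι → Fin N) (ι → Fin N) R) :
    Matrix (ι → Fin N) (ι → Fin N) R :=
  fun r s => (-1 : R) ^ (mpar m s * (mpar m r + 1)) * A r s

/-- A matrix preserving the parity of multi-indices. -/
def IsEven (m : ℕ) (A : Matrix (ι → Fin N) (ι → Fin N) R) : Prop :=
  ∀ r s, mpar m r ≠ mpar m s → A r s = 0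

theorem IsEven.twist_eq {m : ℕ} {A : Matrix (ι → Fin N) (ι → Fin N) R} (hA : IsEven m A) :
    twist m A = A := by
  ext r s
  by_cases h : mpar m r = mpar m s
  · simp [twist, h, (Nat.even_mul_succ_self (mpar m s)).neg_one_pow]
  · simp [twist, hA r s h]

variable [DecidableEq ι]

theorem twist_sMul (m : ℕ) (A B : Matrix (ι → Fin N) (ι → Fin N) R) :
    twist m (sMul m A B) = twist m A * twist m B := by
  ext r t
  simp only [twist, sMul, Matrix.mul_apply, Finset.mul_sum]
  refine Finset.sum_congr rfl fun s _ => ?_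
  rw [neg_one_pow_mul_mul, mul_assoc, ← mul_assoc, ← pow_add]
  congr 1
  apply neg_one_pow_eq_of_zmod
  push_cast
  generalize (mpar m s : ZMod 2) = a
  generalize (mpar m r : ZMod 2) = b
  generalize (mpar m t : ZMod 2) = c
  revert a b c
  decide

theorem IsEven.twist_mul {m : ℕ} {A : Matrix (ι → Fin N) (ι → Fin N) R} (hA : IsEven m A)
    (B : Matrix (ι → Fin N) (ι → Fin N) R) : twist m (A * B) = A * twist m B := by
  ext r t
  simp only [twist, Matrix.mul_apply, Finset.mul_sum]
  refine Finset.sum_congr rfl fun s _ => ?_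
  by_cases h : mpar m r = mpar m s
  · rw [h, ← mul_assoc, ← mul_assoc, ((Commute.neg_one_left (A r s)).pow_left _).eq]
  · simp [hA r s h]

theorem IsEven.mul_twist {m : ℕ} {A : Matrix (ι → Fin N) (ι → Fin N) R} (hA : IsEven m A)
    (B : Matrix (ι → Fin N) (ι → Fin N) R) : twist m (B * A) = twist m B * A := by
  ext r t
  simp only [twist, Matrix.mul_apply, Finset.mul_sum]
  refine Finset.sum_congr rfl fun s _ => ?_
  by_cases h : mpar m s = mpar m t
  · rw [h, mul_assoc]
  · simp [hA s t h]

theorem strace_twist (m : ℕ) (A : Matrix (ι → Fin N) (ι → Fin N) R) :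
    strace m (twist m A) = strace m A := by
  simp [strace, twist, (Nat.even_mul_succ_self _).neg_one_pow]

theorem IsEven.strace_mul_comm {m : ℕ} {A : Matrix (ι → Fin N) (ι → Fin N) R} (hA : IsEven m A)
    (hc : ∀ r s x, A r s * x = x * A r s) (B : Matrix (ι → Fin N) (ι → Fin N) R) :
    strace m (A * B) = strace m (B * A) := by
  simp only [strace, Matrix.mul_apply, Finset.mul_sum]
  rw [Finset.sum_comm]
  refine Finset.sum_congr rfl fun s _ => Finset.sum_congr rfl fun r _ => ?_
  by_cases h : mpar m r = mpar m s
  · rw [h, hc]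
  · simp [hA r s h]

end Twist

section Permutations

variable {R : Type} [Ring R] {l N : ℕ}

theorem sum_sum_eq_sum_lt {M : Type*} [AddCommMonoid M] (F : Fin l → Fin l → M)
    (hF : ∀ p, F p p = 0) :
    ∑ p, ∑ q, F p q = ∑ p, ∑ q, if p < q then F p q + F q p else 0 := by
  have h1 : ∑ p, ∑ q, (if p < q then F q p else 0) = ∑ p, ∑ q, if q < p then F p q else 0 :=
    Finset.sum_comm
  have h2 : ∀ p q, (if p < q then F p q + F q p else 0)
      = (if p < q then F p q else 0) + if p < q then F q p else 0 := by
    intro p q; split_ifs <;> simp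
  simp only [h2, Finset.sum_add_distrib]
  rw [h1, ← Finset.sum_add_distrib]
  refine Finset.sum_congr rfl fun p _ => ?_
  rw [← Finset.sum_add_distrib]
  refine Finset.sum_congr rfl fun q _ => ?_
  rcases lt_trichotomy p q with h | h | h
  · simp [h, h.not_gt]
  · simp [h, hF]
  · simp [h, h.not_gt]

theorem natCast_invExp (m : ℕ) (σ : Equiv.Perm (Fin l)) (s : Fin l → Fin N) :
    (invExp m (· < ·) σ s : ZMod 2)
      = ∑ p, ∑ q, if p < q ∧ σ q < σ p then (par m (s p) : ZMod 2) * par m (s q) else 0 := by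
  simp only [invExp, Finset.sum_filter, Fintype.sum_prod_type]
  push_cast
  rfl

theorem natCast_invExp_mul (m : ℕ) (σ τ : Equiv.Perm (Fin l)) (s : Fin l → Fin N) :
    (invExp m (· < ·) (σ * τ) s : ZMod 2)
      = invExp m (· < ·) σ (s ∘ τ.symm) + invExp m (· < ·) τ s := by
  have h2 : ∀ x : ZMod 2, x + x = 0 := CharTwo.add_self_eq_zero
  simp only [natCast_invExp]
  have e : (∑ p, ∑ q, if p < q ∧ σ q < σ p then
        (par m ((s ∘ τ.symm) p) : ZMod 2) * par m ((s ∘ τ.symm) q) else 0)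
      = ∑ p, ∑ q, if τ p < τ q ∧ σ (τ q) < σ (τ p) then
        (par m (s p) : ZMod 2) * par m (s q) else 0 := by
    rw [← Equiv.sum_comp τ]
    refine Finset.sum_congr rfl fun p _ => ?_
    rw [← Equiv.sum_comp τ]
    simp
  rw [e, sum_sum_eq_sum_lt (fun p q => if τ p < τ q ∧ σ (τ q) < σ (τ p) then
        (par m (s p) : ZMod 2) * par m (s q) else 0) (by simp), ← Finset.sum_add_distrib]
  refine Finset.sum_congr rfl fun p _ => ?_
  rw [← Finset.sum_add_distrib]
  refine Finset.sum_congr rfl fun q _ => ?_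
  by_cases h : p < q
  · have h3 : τ p ≠ τ q := fun e => h.ne (τ.injective e)
    have h4 : σ (τ p) ≠ σ (τ q) := fun e => h3 (σ.injective e)
    rcases h3.lt_or_gt with h3 | h3 <;> rcases h4.lt_or_gt with h4 | h4 <;>
      simp [h, h3, h4, h3.not_gt, h4.not_gt, mul_comm (par m (s q) : ZMod 2), h2]
  · simp [h]

theorem isEven_permMat (m : ℕ) (σ : Equiv.Perm (Fin l)) :
    IsEven m (permMat m (· < ·) σ : Matrix (Fin l → Fin N) (Fin l → Fin N) R) := by
  intro r s h
  refine if_neg fun e => h ?_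
  subst e
  exact Equiv.sum_comp σ.symm (fun v => par m (s v))

theorem permMat_commute (m : ℕ) (σ : Equiv.Perm (Fin l)) (r s : Fin l → Fin N) (x : R) :
    permMat m (· < ·) σ r s * x = x * permMat m (· < ·) σ r s := by
  unfold permMat
  split_ifs
  · exact ((Commute.neg_one_left x).pow_left _).eq
  · simp

theorem permMat_one (m : ℕ) :
    (permMat m (· < ·) (1 : Equiv.Perm (Fin l)) : Matrix (Fin l → Fin N) (Fin l → Fin N) R)
      = 1 := by
  ext r s
  have h : invExp m (· < ·) (1 : Equiv.Perm (Fin l)) s = 0 :=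
    Finset.sum_eq_zero fun p hp => by
      have hp := (Finset.mem_filter.1 hp).2
      exact absurd hp.1 hp.2.not_gt
  have hs : s ∘ (1 : Equiv.Perm (Fin l)).symm = s := rfl
  rw [permMat, h, hs, Matrix.one_apply, pow_zero]

theorem permMat_mul (m : ℕ) (σ τ : Equiv.Perm (Fin l)) :
    (permMat m (· < ·) (σ * τ) : Matrix (Fin l → Fin N) (Fin l → Fin N) R)
      = permMat m (· < ·) σ * permMat m (· < ·) τ := by
  ext r t
  rw [Matrix.mul_apply, Finset.sum_eq_single (t ∘ τ.symm)]
  · have : (t ∘ τ.symm) ∘ σ.symm = t ∘ (σ * τ).symm := rfl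
    simp only [permMat, this]
    by_cases h : r = t ∘ (σ * τ).symm
    · simp only [h, if_true, ← pow_add]
      apply neg_one_pow_eq_of_zmod
      push_cast
      exact natCast_invExp_mul m σ τ t
    · simp [h]
  · intro s _ hs
    simp [permMat, hs]
  · simp

theorem natCast_invExp_add_of_eq_off (m : ℕ) (σ : Equiv.Perm (Fin l)) (v : Fin l)
    (s t : Fin l → Fin N) (h : ∀ w, w ≠ v → s w = t w) :
    (invExp m (· < ·) σ s : ZMod 2) + invExp m (· < ·) σ t
      = (par m (s v) + par m (t v)) *
        ∑ w, ((if w < v then (par m (t w) : ZMod 2) else 0)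
          + if σ w < σ v then (par m (t w) : ZMod 2) else 0) := by
  have h2 : ∀ x : ZMod 2, x + x = 0 := CharTwo.add_self_eq_zero
  have key : ∀ p q : Fin l,
      (if p < q ∧ σ q < σ p then (par m (s p) : ZMod 2) * par m (s q) else 0)
        + (if p < q ∧ σ q < σ p then (par m (t p) : ZMod 2) * par m (t q) else 0)
      = (if p = v then (if v < q ∧ σ q < σ v then
            ((par m (s v) : ZMod 2) + par m (t v)) * par m (t q) else 0) else 0)
        + if q = v then (if p < v ∧ σ v < σ p then
            ((par m (s v) : ZMod 2) + par m (t v)) * par m (t p) else 0) else 0 := by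
    intro p q
    by_cases hpq : p < q ∧ σ q < σ p
    · by_cases hp : p = v
      · subst hp
        simp [hpq, hpq.1.ne', h q hpq.1.ne', add_mul]
      · by_cases hq : q = v
        · subst hq
          simp [hpq, hp, h p hp, mul_add, mul_comm]
        · simp [hpq, hp, hq, h p hp, h q hq, h2]
    · have e1 : (if p = v then (if v < q ∧ σ q < σ v then
            ((par m (s v) : ZMod 2) + par m (t v)) * par m (t q) else 0) else 0) = 0 := by
        split_ifs with h3 h4
        · subst h3; exact absurd h4 hpq
        all_goals rfl
      have e2 : (if q = v then (if p < v ∧ σ v < σ p then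
            ((par m (s v) : ZMod 2) + par m (t v)) * par m (t p) else 0) else 0) = 0 := by
        split_ifs with h3 h4
        · subst h3; exact absurd h4 hpq
        all_goals rfl
      rw [e1, e2]
      simp [hpq]
  simp only [natCast_invExp, ← Finset.sum_add_distrib, key]
  simp only [Finset.sum_add_distrib, Finset.sum_ite_eq', Finset.mem_univ, if_true]
  rw [Finset.sum_comm]
  simp only [Finset.sum_ite_eq', Finset.mem_univ, if_true, mul_add, Finset.mul_sum]
  simp only [← Finset.sum_add_distrib]
  refine Finset.sum_congr rfl fun w _ => ?_
  rcases lt_trichotomy w v with h3 | h3 | h3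
  · have h4 : σ w ≠ σ v := fun e => h3.ne (σ.injective e)
    rcases h4.lt_or_gt with h4 | h4 <;> simp [h3, h4, h3.not_gt, h4.not_gt, h2]
  · simp [h3]
  · have h4 : σ w ≠ σ v := fun e => h3.ne' (σ.injective e)
    rcases h4.lt_or_gt with h4 | h4 <;> simp [h3, h4, h3.not_gt, h4.not_gt]

theorem permMat_mul_embed (m : ℕ) (σ : Equiv.Perm (Fin l)) (v : Fin l) (f : Fin N → Fin N → R) :
    permMat m (· < ·) σ * embed m (· < ·) v f
      = embed m (· < ·) (σ v) f * permMat m (· < ·) σ := by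
  ext r t
  obtain ⟨r, rfl⟩ : ∃ r' : Fin l → Fin N, r = r' ∘ σ.symm := ⟨r ∘ σ, by ext; simp⟩
  rw [Matrix.mul_apply, Matrix.mul_apply, Finset.sum_eq_single r,
    Finset.sum_eq_single (t ∘ σ.symm)]
  · have hiff : (∀ w, w ≠ σ v → (r ∘ σ.symm) w = (t ∘ σ.symm) w) ↔ ∀ w, w ≠ v → r w = t w := by
      rw [← σ.forall_congr_right]
      simp
    simp only [permMat, embed, if_true, hiff]
    split_ifs with h
    · rw [← ((Commute.neg_one_left (_ * _)).pow_left _).eq]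
      simp only [← mul_assoc, ← pow_add, Function.comp, Equiv.symm_apply_apply]
      congr 1
      apply neg_one_pow_eq_of_zmod
      have e := natCast_invExp_add_of_eq_off m σ v r t h
      push_cast [Finset.sum_filter]
      rw [← Equiv.sum_comp σ (fun w => if w < σ v then _ else _)]
      simp only [Equiv.symm_apply_apply]
      rw [Finset.sum_add_distrib, mul_add] at e
      generalize (invExp m (· < ·) σ r : ZMod 2) = a at *
      generalize (invExp m (· < ·) σ t : ZMod 2) = b at *
      generalize (((par m (r v) : ZMod 2) + par m (t v)) * _) = c at *
      generalize (((par m (r v) : ZMod 2) + par m (t v)) * _) = d at *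
      revert a b c d
      decide
    · simp
  · intro s _ hs
    simp [permMat, hs]
  · simp
  · intro s _ hs
    rw [permMat, if_neg, zero_mul]
    intro e
    exact hs (by ext w; simpa using (congrArg Fin.val (congrFun e (σ w))).symm)
  · simp

end Permutations

section Embeddings

variable {R : Type} [Ring R] {l N : ℕ}

theorem mpar_add_par_of_eq_off (m : ℕ) (v : Fin l) (r s : Fin l → Fin N)
    (h : ∀ w, w ≠ v → r w = s w) : mpar m r + par m (s v) = mpar m s + par m (r v) := by
  have e : ∑ w ∈ Finset.univ.erase v, par m (r w) = ∑ w ∈ Finset.univ.erase v, par m (s w) :=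
    Finset.sum_congr rfl fun w hw => by rw [h w (Finset.ne_of_mem_erase hw)]
  have hr := Finset.add_sum_erase Finset.univ (fun w => par m (r w)) (Finset.mem_univ v)
  have hs := Finset.add_sum_erase Finset.univ (fun w => par m (s w)) (Finset.mem_univ v)
  simp only [mpar]
  omega

theorem isEven_embed (m : ℕ) (v : Fin l) (q : Fin N → Fin N → R)
    (hq : ∀ a b, par m a ≠ par m b → q a b = 0) : IsEven m (embed m (· < ·) v q) := by
  intro r s h
  unfold embed
  split_ifs with h1
  · rw [hq _ _ fun e => h ?_, mul_zero]
    have := mpar_add_par_of_eq_off m v r s h1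
    omega
  · rfl

theorem embed_apply_of_even (m : ℕ) (v : Fin l) (q : Fin N → Fin N → R)
    (hq : ∀ a b, par m a ≠ par m b → q a b = 0) (r s : Fin l → Fin N) :
    embed m (· < ·) v q r s = if ∀ w, w ≠ v → r w = s w then q (r v) (s v) else 0 := by
  unfold embed
  split_ifs with h1
  · by_cases h : par m (r v) = par m (s v)
    · rw [h, Even.neg_one_pow (Even.mul_right ⟨_, rfl⟩ _), one_mul]
    · rw [hq _ _ h, mul_zero]
  · rfl

theorem eq_off_iff_eq_update (v : Fin l) (r s : Fin l → Fin N) :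
    (∀ w, w ≠ v → r w = s w) ↔ s = Function.update r v (s v) := by
  constructor
  · intro h
    ext w
    by_cases hw : w = v
    · subst hw; simp
    · simp [hw, h w hw]
  · intro h w hw
    rw [h]
    simp [hw]

theorem sum_eq_off {M : Type*} [AddCommMonoid M] (v : Fin l) (r : Fin l → Fin N)
    (F : (Fin l → Fin N) → M) :
    (∑ s, if ∀ w, w ≠ v → r w = s w then F s else 0) = ∑ c, F (Function.update r v c) := by
  rw [← Finset.sum_filter]
  symm
  refine Finset.sum_bij' (fun c _ => Function.update r v c) (fun s _ => s v) ?_ ?_ ?_ ?_ ?_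
  · intro c _
    simp only [Finset.mem_filter, Finset.mem_univ, true_and]
    intro w hw
    simp [hw]
  · simp
  · simp
  · intro s hs
    exact ((eq_off_iff_eq_update v r s).1 (Finset.mem_filter.1 hs).2).symm
  · simp

theorem embed_mul_embed_of_even (m : ℕ) (v : Fin l) (q f : Fin N → Fin N → R)
    (hq : ∀ a b, par m a ≠ par m b → q a b = 0) :
    embed m (· < ·) v q * embed m (· < ·) v f
      = embed m (· < ·) v fun a b => ∑ c, q a c * f c b := by
  ext r t
  simp only [Matrix.mul_apply, embed_apply_of_even m v q hq, ite_mul, zero_mul, sum_eq_off]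
  unfold embed
  have hiff : ∀ c, (∀ w, w ≠ v → Function.update r v c w = t w) ↔ ∀ w, w ≠ v → r w = t w :=
    fun c => forall_congr' fun w => imp_congr_right fun hw => by simp [hw]
  simp only [hiff, Function.update_self]
  split_ifs with h
  · rw [Finset.mul_sum]
    refine Finset.sum_congr rfl fun c _ => ?_
    by_cases hc : par m (r v) = par m c
    · rw [hc, ← mul_assoc, ← mul_assoc, ((Commute.neg_one_left (q _ _)).pow_left _).eq]
    · simp [hq _ _ hc]
  · simp

theorem embed_commute_of_even (m : ℕ) {i j : Fin l} (hij : i ≠ j) (q f : Fin N → Fin N → R)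
    (hq : ∀ a b, par m a ≠ par m b → q a b = 0) (hc : ∀ a b x, q a b * x = x * q a b) :
    Commute (embed m (· < ·) j q) (embed m (· < ·) i f) := by
  ext r t
  have hsymm : ∀ s : Fin l → Fin N, (∀ w, w ≠ j → s w = t w) ↔ ∀ w, w ≠ j → t w = s w :=
    fun s => forall_congr' fun w => imp_congr_right fun _ => eq_comm
  simp only [Matrix.mul_apply, embed_apply_of_even m j q hq, ite_mul, zero_mul, mul_ite, mul_zero]
  simp only [hsymm, sum_eq_off]
  have h1 : ∀ c, (∀ w, w ≠ i → Function.update r j c w = t w)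
      ↔ c = t j ∧ ∀ w, w ≠ i → w ≠ j → r w = t w := by
    intro c
    constructor
    · intro h
      exact ⟨by simpa using h j hij.symm, fun w hw hw' => by simpa [hw'] using h w hw⟩
    · rintro ⟨rfl, h⟩ w hw
      by_cases hw' : w = j
      · subst hw'; simp
      · simp [hw', h w hw hw']
  have h2 : ∀ c, (∀ w, w ≠ i → r w = Function.update t j c w)
      ↔ c = r j ∧ ∀ w, w ≠ i → w ≠ j → r w = t w := by
    intro c
    constructor
    · intro h
      exact ⟨by simpa using (h j hij.symm).symm, fun w hw hw' => by simpa [hw'] using h w hw⟩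
    · rintro ⟨rfl, h⟩ w hw
      by_cases hw' : w = j
      · subst hw'; simp
      · simp [hw', h w hw hw']
  unfold embed
  simp only [h1, h2, ite_and, mul_ite, mul_zero, ite_mul, zero_mul, Finset.sum_ite_eq',
    Finset.mem_univ, if_true, Function.update_self, Function.update_of_ne hij]
  split_ifs with h
  · by_cases hp : par m (r j) = par m (t j)
    · rw [hc]
      congr 3
      congr 1
      refine Finset.sum_congr rfl fun w _ => ?_
      by_cases hw : w = j
      · subst hw; simp [hp]
      · simp [hw]
    · simp [hq _ _ hp]
  · rfl

theorem mpar_cons (m : ℕ) (c : Fin N) (r : Fin l → Fin N) :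
    mpar m (Fin.cons c r : Fin (l + 1) → Fin N) = par m c + mpar m r := by
  simp [mpar, Fin.sum_univ_succ]

theorem twist_embed_succ (m : ℕ) (v : Fin l) (f : Fin N → Fin N → R) (c d : Fin N)
    (r s : Fin l → Fin N) :
    twist m (embed m (· < ·) v.succ f) (Fin.cons c r : Fin (l + 1) → Fin N) (Fin.cons d s)
      = if c = d then twist m (embed m (· < ·) v f) r s else 0 := by
  have hiff : (∀ w, w ≠ v.succ →
      (Fin.cons c r : Fin (l + 1) → Fin N) w = Fin.cons (α := fun _ => Fin N) d s w)
      ↔ c = d ∧ ∀ w, w ≠ v → r w = s w := by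
    rw [Fin.forall_fin_succ]
    simp [Fin.succ_ne_zero, eq_comm (a := (0 : Fin (l + 1)))]
  simp only [twist, embed, hiff, mpar_cons, ite_and]
  split_ifs with h1 h2
  · subst h1
    simp only [Fin.cons_succ, ← mul_assoc, ← pow_add]
    congr 1
    apply neg_one_pow_eq_of_zmod
    have e := congrArg (Nat.cast : ℕ → ZMod 2) (mpar_add_par_of_eq_off m v r s h2)
    push_cast [Finset.sum_filter, Fin.sum_univ_succ] at e ⊢
    simp only [Fin.cons_zero, Fin.cons_succ, Fin.succ_pos, if_true, Fin.succ_lt_succ_iff]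
    generalize (∑ w, if w < v then (par m (s w) : ZMod 2) else 0) = L at *
    generalize (par m (r v) : ZMod 2) = x at *
    generalize (par m (s v) : ZMod 2) = y at *
    generalize (par m c : ZMod 2) = z at *
    generalize (mpar m r : ZMod 2) = a at *
    generalize (mpar m s : ZMod 2) = b at *
    revert a b x y z L
    decide
  · simp
  · simp

end Embeddings

section Contraction

theorem ext_cons {α : Type*} {l N : ℕ} {A B : Matrix (Fin (l + 1) → Fin N) (Fin (l + 1) → Fin N) α}
    (h : ∀ c d r s, A (Fin.cons c r) (Fin.cons d s) = B (Fin.cons c r) (Fin.cons d s)) :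
    A = B := by
  ext r s
  rw [← Fin.cons_self_tail r, ← Fin.cons_self_tail s]
  exact h _ _ _ _

variable {R : Type} [Ring R] {l N : ℕ}

theorem sum_fin_succ_fun {M : Type*} [AddCommMonoid M] (F : (Fin (l + 1) → Fin N) → M) :
    ∑ x, F x = ∑ c, ∑ r, F (Fin.cons c r) := by
  rw [← Fintype.sum_prod_type']
  exact (Equiv.sum_comp (Fin.consEquiv fun _ : Fin (l + 1) => Fin N) F).symm

theorem natCast_invExp_swap_zero (m : ℕ) (j : Fin l) (s : Fin (l + 1) → Fin N)
    (hs : s 0 = s j.succ) :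
    (invExp m (· < ·) (Equiv.swap 0 j.succ) s : ZMod 2) = par m (s 0) := by
  have h2 : ∀ x : ZMod 2, x + x = 0 := CharTwo.add_self_eq_zero
  have h3 : ∀ x : ZMod 2, x * x = x := by decide
  have key : ∀ p q : Fin (l + 1),
      (if p < q ∧ Equiv.swap 0 j.succ q < Equiv.swap 0 j.succ p
        then (par m (s p) : ZMod 2) * par m (s q) else 0)
      = (if p = 0 then (if 0 < q ∧ q ≤ j.succ then
            (par m (s 0) : ZMod 2) * par m (s q) else 0) else 0)
        + if q = j.succ then (if 0 < p ∧ p < j.succ then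
            (par m (s 0) : ZMod 2) * par m (s p) else 0) else 0 := by
    intro p q
    have hj : 0 < j.succ := Fin.succ_pos j
    by_cases hp : p = 0
    · subst hp
      by_cases hq : q = j.succ
      · subst hq; simp
      · by_cases hq0 : q = 0
        · subst hq0; simp
        · have hlt : q < j.succ ↔ q ≤ j.succ := ⟨le_of_lt, fun h => lt_of_le_of_ne h hq⟩
          simp [hq, Equiv.swap_apply_of_ne_of_ne hq0 hq, hlt]
    · by_cases hq : q = j.succ
      · subst hq
        by_cases hpj : p = j.succ
        · simp [hpj]
        · simp [hp, Equiv.swap_apply_of_ne_of_ne hp hpj, ← hs, mul_comm, Fin.pos_iff_ne_zero]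
      · by_cases hpj : p = j.succ
        · simp [hpj, hq]
        · by_cases hq0 : q = 0
          · simp [hq0, (Fin.succ_ne_zero j).symm]
          · have : ¬ (p < q ∧ q < p) := fun h => h.1.not_gt h.2
            simp [hp, hq, Equiv.swap_apply_of_ne_of_ne hp hpj,
              Equiv.swap_apply_of_ne_of_ne hq0 hq, this]
  simp only [natCast_invExp, key, Finset.sum_add_distrib]
  rw [Finset.sum_comm]
  simp only [Finset.sum_ite_eq', Finset.mem_univ, if_true]
  rw [← Finset.sum_add_distrib, Finset.sum_eq_single j.succ]
  · simp [← hs, h3]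
  · intro w _ hw
    have hlt : w < j.succ ↔ w ≤ j.succ := ⟨le_of_lt, fun h => lt_of_le_of_ne h hw⟩
    simp [hlt, h2]
  · simp

theorem permMat_swap_zero_cons (m : ℕ) (j : Fin l) (c : Fin N) (s r : Fin l → Fin N) :
    (permMat m (· < ·) (Equiv.swap 0 j.succ) (Fin.cons c s : Fin (l + 1) → Fin N)
      (Fin.cons c r) : R)
      = if c = r j then (if s = r then (-1) ^ par m c else 0) else 0 := by
  have hiff : (Fin.cons c s : Fin (l + 1) → Fin N)
      = Fin.cons (α := fun _ => Fin N) c r ∘ (Equiv.swap 0 j.succ).symm ↔ c = r j ∧ s = r := by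
    rw [Equiv.symm_swap, funext_iff, Fin.forall_fin_succ]
    simp only [Fin.cons_zero, Function.comp, Equiv.swap_apply_left, Fin.cons_succ]
    refine and_congr_right fun hc => ?_
    rw [funext_iff]
    refine forall_congr' fun i => ?_
    by_cases hi : i = j
    · subst hi
      simp [hc]
    · rw [Equiv.swap_apply_of_ne_of_ne (Fin.succ_ne_zero _) (by simpa using hi), Fin.cons_succ]
  simp only [permMat, hiff, ite_and]
  split_ifs with h1 h2
  · apply neg_one_pow_eq_of_zmod
    rw [natCast_invExp_swap_zero _ _ _ (by simpa using h1)]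
    simp
  · rfl
  · rfl

/-- The matrix `1 ⊗ M`. -/
def oneTensor (M : Matrix (Fin l → Fin N) (Fin l → Fin N) R) :
    Matrix (Fin (l + 1) → Fin N) (Fin (l + 1) → Fin N) R :=
  fun r s => if r 0 = s 0 then M (Fin.tail r) (Fin.tail s) else 0

theorem oneTensor_cons (M : Matrix (Fin l → Fin N) (Fin l → Fin N) R) (c d : Fin N)
    (r s : Fin l → Fin N) :
    oneTensor M (Fin.cons c r : Fin (l + 1) → Fin N) (Fin.cons d s)
      = if c = d then M r s else 0 := by
  simp [oneTensor]

theorem oneTensor_mul (M M' : Matrix (Fin l → Fin N) (Fin l → Fin N) R) :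
    oneTensor (M * M') = oneTensor M * oneTensor M' := by
  refine ext_cons fun c d r s => ?_
  simp only [Matrix.mul_apply, sum_fin_succ_fun, oneTensor_cons, ite_mul, zero_mul]
  simp only [Finset.sum_comm (s := Finset.univ (α := Fin N)), Finset.sum_ite_eq, Finset.mem_univ,
    if_true, mul_ite, mul_zero]
  split_ifs <;> simp

theorem oneTensor_one :
    oneTensor (1 : Matrix (Fin l → Fin N) (Fin l → Fin N) R) = 1 := by
  refine ext_cons fun c d r s => ?_
  simp only [oneTensor_cons, Matrix.one_apply, Fin.cons_inj, ite_and]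

theorem twist_embed_succ_eq_oneTensor (m : ℕ) (v : Fin l) (f : Fin N → Fin N → R) :
    twist m (embed m (· < ·) v.succ f) = oneTensor (twist m (embed m (· < ·) v f)) :=
  ext_cons fun c d r s => by rw [twist_embed_succ, oneTensor_cons]

theorem permMat_decomposeFin (m : ℕ) (e : Equiv.Perm (Fin l)) :
    (permMat m (· < ·) (Equiv.Perm.decomposeFin.symm (0, e)) :
        Matrix (Fin (l + 1) → Fin N) (Fin (l + 1) → Fin N) R)
      = oneTensor (permMat m (· < ·) e) := by
  refine ext_cons fun c d r s => ?_
  rw [oneTensor_cons]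
  set E := Equiv.Perm.decomposeFin.symm (0, e) with hE
  have h0 : E 0 = 0 := by simp [hE]
  have h1 : ∀ i : Fin l, E i.succ = (e i).succ := by intro i; simp [hE]
  have hiff : (Fin.cons c r : Fin (l + 1) → Fin N)
      = Fin.cons (α := fun _ => Fin N) d s ∘ E.symm ↔ c = d ∧ r = s ∘ e.symm := by
    have h0' : E.symm 0 = 0 := E.symm_apply_eq.2 h0.symm
    have h1' : ∀ i : Fin l, E.symm i.succ = (e.symm i).succ := fun i =>
      E.symm_apply_eq.2 (by rw [h1, Equiv.apply_symm_apply])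
    rw [funext_iff, Fin.forall_fin_succ, funext_iff]
    simp only [Function.comp, h0', h1', Fin.cons_zero, Fin.cons_succ]
  simp only [permMat, hiff, ite_and]
  congr 2
  apply neg_one_pow_eq_of_zmod
  simp [natCast_invExp, Fin.sum_univ_succ, h0, h1]

theorem permMat_decomposeFin_symm (m : ℕ) {l : ℕ} (p : Fin (l + 1)) (e : Equiv.Perm (Fin l)) :
    (permMat m (· < ·) (Equiv.Perm.decomposeFin.symm (p, e)) :
        Matrix (Fin (l + 1) → Fin N) (Fin (l + 1) → Fin N) R)
      = permMat m (· < ·) (Equiv.swap 0 p) * oneTensor (permMat m (· < ·) e) := by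
  rw [← permMat_decomposeFin, ← permMat_mul]
  congr 1
  ext x
  refine Fin.cases ?_ (fun i => ?_) x <;> simp

theorem strace_oneTensor (m : ℕ) (M : Matrix (Fin l → Fin N) (Fin l → Fin N) R) :
    strace m (oneTensor M) = (∑ c : Fin N, (-1 : R) ^ par m c) * strace m M := by
  simp only [strace, sum_fin_succ_fun, oneTensor_cons, if_true, mpar_cons, pow_add, mul_assoc,
    Finset.sum_mul_sum]

theorem strace_oneTensor_mul_swap (m : ℕ) (M : Matrix (Fin l → Fin N) (Fin l → Fin N) R)
    (j : Fin l) :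
    strace m (oneTensor M * permMat m (· < ·) (Equiv.swap 0 j.succ)) = strace m M := by
  simp only [strace, sum_fin_succ_fun, Matrix.mul_apply, oneTensor_cons, mpar_cons]
  rw [Finset.sum_comm]
  refine Finset.sum_congr rfl fun r _ => ?_
  rw [Finset.sum_eq_single (r j)]
  · rw [Finset.sum_eq_single (r j)]
    · simp only [if_true, permMat_swap_zero_cons, mul_ite, mul_zero, Finset.sum_ite_eq',
        Finset.mem_univ]
      rw [← ((Commute.neg_one_left (M r r)).pow_left _).eq, ← mul_assoc, ← pow_add]
      congr 1
      apply neg_one_pow_eq_of_zmod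
      push_cast
      generalize (par m (r j) : ZMod 2) = a
      generalize (mpar m r : ZMod 2) = b
      revert a b
      decide
    · intro d _ hd
      simp [hd.symm]
    · simp
  · intro c _ hc
    have : ∑ d, ∑ s, (if c = d then M r s else 0) * (permMat m (· < ·) (Equiv.swap 0 j.succ)
        (Fin.cons d s : Fin (l + 1) → Fin N) (Fin.cons c r) : R) = 0 := by
      refine Finset.sum_eq_zero fun d _ => Finset.sum_eq_zero fun s _ => ?_
      split_ifs with h
      · subst h
        simp [permMat_swap_zero_cons, hc]
      · simp
    rw [this, mul_zero]
  · simp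

end Contraction

section Antisymmetrizer

variable {R : Type} [Ring R] {N : ℕ}

theorem strace_sum {ι κ : Type} [Fintype ι] [DecidableEq ι] (m : ℕ) (s : Finset κ)
    (F : κ → Matrix (ι → Fin N) (ι → Fin N) R) :
    strace m (∑ i ∈ s, F i) = ∑ i ∈ s, strace m (F i) := by
  simp only [strace, Matrix.sum_apply, Finset.mul_sum]
  exact Finset.sum_comm

variable [Algebra ℂ R]

theorem strace_smul {ι : Type} [Fintype ι] [DecidableEq ι] (m : ℕ) (c : ℂ)
    (M : Matrix (ι → Fin N) (ι → Fin N) R) : strace m (c • M) = c • strace m M := by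
  simp only [strace, Matrix.smul_apply, Finset.smul_sum, mul_smul_comm]

/-- The antisymmetrizer with entries in a `ℂ`-algebra. -/
def asymm (R : Type) [Ring R] [Algebra ℂ R] (m N l : ℕ) :
    Matrix (Fin l → Fin N) (Fin l → Fin N) R := (asymmZ m N l).map (algebraMap ℂ R)

theorem asymm_eq (m l : ℕ) :
    asymm R m N l = ((l.factorial : ℂ))⁻¹ •
      ∑ σ : Equiv.Perm (Fin l), (((Equiv.Perm.sign σ : ℤ) : ℂ)) • permMat m (· < ·) σ := by
  ext r s
  simp only [asymm, asymmZ, Matrix.map_apply, Matrix.smul_apply, Matrix.sum_apply]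
  rw [smul_eq_mul, map_mul, ← Algebra.smul_def, map_sum]
  refine congrArg _ (Finset.sum_congr rfl fun σ _ => ?_)
  simp [permMat, Algebra.smul_def, apply_ite (algebraMap ℂ R)]

theorem isEven_asymm (m l : ℕ) : IsEven m (asymm R m N l) := by
  intro r s h
  rw [asymm_eq, Matrix.smul_apply, Matrix.sum_apply, Finset.sum_eq_zero, smul_zero]
  intro σ _
  rw [Matrix.smul_apply, isEven_permMat m σ r s h, smul_zero]

theorem asymm_commute (m l : ℕ) (r s : Fin l → Fin N) (x : R) :
    asymm R m N l r s * x = x * asymm R m N l r s :=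
  Algebra.commutes _ _

theorem sign_mul_sign_cast {l : ℕ} (σ : Equiv.Perm (Fin l)) :
    ((Equiv.Perm.sign σ : ℤ) : ℂ) * ((Equiv.Perm.sign σ : ℤ) : ℂ) = 1 := by
  rw [← Int.cast_mul, Int.units_coe_mul_self, Int.cast_one]

theorem permMat_mul_asymm (m l : ℕ) (σ : Equiv.Perm (Fin l)) :
    permMat m (· < ·) σ * asymm R m N l = ((Equiv.Perm.sign σ : ℤ) : ℂ) • asymm R m N l := by
  rw [asymm_eq, mul_smul_comm, smul_comm, Finset.mul_sum]
  refine congrArg _ ?_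
  rw [Finset.smul_sum]
  conv_rhs => rw [← Equiv.sum_comp (Equiv.mulLeft σ)]
  refine Finset.sum_congr rfl fun τ _ => ?_
  simp only [Equiv.coe_mulLeft]
  rw [mul_smul_comm, ← permMat_mul, smul_smul, Equiv.Perm.sign_mul]
  push_cast
  rw [← mul_assoc, sign_mul_sign_cast, one_mul]

theorem asymm_mul_permMat (m l : ℕ) (σ : Equiv.Perm (Fin l)) :
    asymm R m N l * permMat m (· < ·) σ = ((Equiv.Perm.sign σ : ℤ) : ℂ) • asymm R m N l := by
  rw [asymm_eq, smul_mul_assoc, smul_comm, Finset.sum_mul]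
  refine congrArg _ ?_
  rw [Finset.smul_sum]
  conv_rhs => rw [← Equiv.sum_comp (Equiv.mulRight σ)]
  refine Finset.sum_congr rfl fun τ _ => ?_
  simp only [Equiv.coe_mulRight]
  rw [smul_mul_assoc, ← permMat_mul, smul_smul, Equiv.Perm.sign_mul]
  push_cast
  rw [mul_left_comm, sign_mul_sign_cast, mul_one]

theorem strace_oneTensor_mul_asymm_succ (m l : ℕ) (d : ℂ)
    (hd : ∑ c : Fin N, (-1 : R) ^ par m c = algebraMap ℂ R d)
    (M : Matrix (Fin l → Fin N) (Fin l → Fin N) R) :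
    strace m (oneTensor M * asymm R m N (l + 1))
      = ((d - l) / (l + 1)) • strace m (M * asymm R m N l) := by
  have hp : ∀ (p : Fin (l + 1)) (e : Equiv.Perm (Fin l)),
      strace m (oneTensor M * permMat m (· < ·) (Equiv.Perm.decomposeFin.symm (p, e)))
        = (if p = 0 then d else 1) • strace m (M * permMat m (· < ·) e) := by
    intro p e
    have hE : strace m (oneTensor M * permMat m (· < ·) (Equiv.Perm.decomposeFin.symm (p, e)))
        = strace m (oneTensor (permMat m (· < ·) e * M) * permMat m (· < ·) (Equiv.swap 0 p)) := by
      rw [permMat_decomposeFin_symm, oneTensor_mul, ← permMat_decomposeFin, mul_assoc,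
        (isEven_permMat m _).strace_mul_comm (permMat_commute m _), mul_assoc]
    rw [hE, ← (isEven_permMat m e).strace_mul_comm (permMat_commute m e)]
    refine Fin.cases ?_ (fun j => ?_) p
    · have : Equiv.swap (0 : Fin (l + 1)) 0 = 1 := Equiv.swap_self 0
      rw [this, permMat_one, mul_one, strace_oneTensor, hd, if_pos rfl, Algebra.smul_def]
    · rw [strace_oneTensor_mul_swap, if_neg (Fin.succ_ne_zero j), one_smul]
  rw [asymm_eq, asymm_eq, mul_smul_comm, mul_smul_comm, strace_smul, strace_smul,
    Finset.mul_sum, Finset.mul_sum, strace_sum, strace_sum]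
  simp only [mul_smul_comm, strace_smul]
  rw [← Equiv.sum_comp Equiv.Perm.decomposeFin.symm, Fintype.sum_prod_type, Finset.sum_comm]
  simp only [hp, Equiv.Perm.decomposeFin.symm_sign, Fin.sum_univ_succ, if_true,
    Fin.succ_ne_zero, if_false, Finset.sum_const, Finset.card_univ, Fintype.card_fin,
    one_mul, neg_mul, Units.val_neg, Int.cast_neg, neg_smul, smul_neg, smul_smul,
    ← Nat.cast_smul_eq_nsmul ℂ l]
  rw [Finset.smul_sum, Finset.smul_sum]
  refine Finset.sum_congr rfl fun e _ => ?_
  rw [← sub_eq_add_neg, ← sub_smul, smul_smul, smul_smul]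
  congr 1
  have h1 : ((l : ℂ) + 1) ≠ 0 := by exact_mod_cast Nat.succ_ne_zero l
  have h2 : ((l.factorial : ℕ) : ℂ) ≠ 0 := by exact_mod_cast l.factorial_ne_zero
  rw [Nat.factorial_succ]
  push_cast
  field_simp

end Antisymmetrizer

section OrderedProducts

variable {R : Type} [Ring R] {l N : ℕ}

/-- The product `X^{(s₀)}(G 0) X^{(s₁)}(G 1) ⋯` over the slots in the list `S = [s₀, s₁, …]`. -/
def slotProd (m : ℕ) (G : ℕ → Fin N → Fin N → R) (S : List (Fin l)) :
    Matrix (Fin l → Fin N) (Fin l → Fin N) R :=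
  (S.zipIdx.map fun x => twist m (embed m (· < ·) x.1 (G x.2))).prod

theorem slotProd_nil (m : ℕ) (G : ℕ → Fin N → Fin N → R) :
    slotProd m G ([] : List (Fin l)) = 1 := rfl

theorem slotProd_append (m : ℕ) (G : ℕ → Fin N → Fin N → R) (S : List (Fin l)) (i : Fin l) :
    slotProd m G (S ++ [i]) = slotProd m G S * twist m (embed m (· < ·) i (G S.length)) := by
  simp [slotProd, List.zipIdx_append]

theorem permMat_mul_slotProd (m : ℕ) (G : ℕ → Fin N → Fin N → R) (σ : Equiv.Perm (Fin l))
    (S : List (Fin l)) :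
    permMat m (· < ·) σ * slotProd m G S = slotProd m G (S.map σ) * permMat m (· < ·) σ := by
  induction S using List.reverseRecOn with
  | nil => simp [slotProd_nil]
  | append_singleton S i ih =>
    rw [List.map_append, List.map_singleton, slotProd_append, slotProd_append, ← mul_assoc, ih,
      mul_assoc, ← (isEven_permMat m σ).twist_mul, permMat_mul_embed,
      (isEven_permMat m σ).mul_twist, mul_assoc, List.length_map]

theorem slotProd_map_succ (m : ℕ) (G : ℕ → Fin N → Fin N → R) (S : List (Fin l)) :
    slotProd m G (S.map Fin.succ) = oneTensor (slotProd m G S) := by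
  induction S using List.reverseRecOn with
  | nil => simp [slotProd_nil, oneTensor_one]
  | append_singleton S i ih =>
    rw [List.map_append, List.map_singleton, slotProd_append, slotProd_append, ih,
      twist_embed_succ_eq_oneTensor, oneTensor_mul, List.length_map]

theorem exists_perm_map_eq {S S' : List (Fin l)} (hS : S.Nodup) (hS' : S'.Nodup)
    (h : S.length = S'.length) : ∃ σ : Equiv.Perm (Fin l), S.map σ = S' := by
  have := Equiv.Perm.isMultiplyPretransitive (Fin l) S.length
  let x : Fin S.length ↪ Fin l := ⟨S.get, List.nodup_iff_injective_get.1 hS⟩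
  let y : Fin S.length ↪ Fin l := ⟨fun i => S'.get (i.cast h),
    (List.nodup_iff_injective_get.1 hS').comp (Fin.cast_injective h)⟩
  obtain ⟨σ, hσ⟩ := MulAction.exists_smul_eq (Equiv.Perm (Fin l)) x y
  refine ⟨σ, List.ext_getElem (by simpa using h) fun i h1 h2 => ?_⟩
  have hi : i < S.length := by simpa using h1
  have := DFunLike.congr_fun hσ ⟨i, hi⟩
  simpa [x, y] using this

variable [Algebra ℂ R]

theorem strace_slotProd_map_perm (m : ℕ) (G : ℕ → Fin N → Fin N → R) (σ : Equiv.Perm (Fin l))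
    (S : List (Fin l)) :
    strace m (slotProd m G (S.map σ) * asymm R m N l)
      = strace m (slotProd m G S * asymm R m N l) := by
  have h1 : slotProd m G (S.map σ) * asymm R m N l = ((Equiv.Perm.sign σ : ℤ) : ℂ) •
      (permMat m (· < ·) σ * (slotProd m G S * asymm R m N l)) := by
    rw [← mul_assoc, permMat_mul_slotProd, mul_assoc, permMat_mul_asymm, mul_smul_comm, smul_smul,
      sign_mul_sign_cast, one_smul]
  rw [h1, strace_smul, (isEven_permMat m σ).strace_mul_comm (permMat_commute m σ), mul_assoc,
    asymm_mul_permMat, mul_smul_comm, strace_smul, smul_smul, sign_mul_sign_cast, one_smul]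

theorem strace_slotProd_eq (m : ℕ) (G : ℕ → Fin N → Fin N → R) (d : ℂ)
    (hd : ∑ c : Fin N, (-1 : R) ^ par m c = algebraMap ℂ R d) {k : ℕ} (l : ℕ) (hkl : k ≤ l)
    (S : List (Fin l)) (hS : S.Nodup) (hk : S.length = k) :
    strace m (slotProd m G S * asymm R m N l)
      = (∏ j ∈ Finset.Ico k l, (d - j) / (j + 1)) •
        strace m (slotProd m G (List.finRange k).reverse * asymm R m N k) := by
  induction l, hkl using Nat.le_induction with
  | base =>
    obtain ⟨σ, hσ⟩ := exists_perm_map_eq (List.nodup_reverse.2 (List.nodup_finRange k)) hS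
      (by simp [hk])
    rw [← hσ, strace_slotProd_map_perm]
    simp
  | succ l hkl ih =>
    have hnd : ((List.finRange l).take k).Nodup := (List.nodup_finRange l).take
    have hlen : ((List.finRange l).take k).length = k := by simp [hkl]
    obtain ⟨σ, hσ⟩ := exists_perm_map_eq (hnd.map (Fin.succ_injective l)) hS (by simp [hk, hkl])
    rw [← hσ, strace_slotProd_map_perm, slotProd_map_succ,
      strace_oneTensor_mul_asymm_succ m l d hd, ih _ hnd hlen, Finset.prod_Ico_succ_top hkl,
      smul_smul, mul_comm]

end OrderedProducts

section Expansion

variable {R : Type} [Ring R] {l N : ℕ}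

theorem exists_sublists_of_recursion (m : ℕ) (G : ℕ → Fin N → Fin N → R)
    (E : List (Fin l) → ℕ → Matrix (Fin l → Fin N) (Fin l → Fin N) R)
    (h0 : ∀ k, E [] k = if k = 0 then 1 else 0)
    (hz : ∀ S i, E (S ++ [i]) 0 = E S 0)
    (hs : ∀ S i k, E (S ++ [i]) (k + 1)
      = E S (k + 1) - E S k * twist m (embed m (· < ·) i (G k)))
    (S : List (Fin l)) (k : ℕ) :
    ∃ L : List (List (Fin l)), L.length = S.length.choose k ∧
      (∀ T ∈ L, T.Sublist S ∧ T.length = k) ∧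
      E S k = (-1) ^ k * (L.map (slotProd m G)).sum := by
  induction S using List.reverseRecOn generalizing k with
  | nil =>
    cases k with
    | zero => exact ⟨[[]], by simp [h0, slotProd_nil]⟩
    | succ k => exact ⟨[], by simp [h0]⟩
  | append_singleton S i ih =>
    cases k with
    | zero =>
      obtain ⟨L, hL, hT, hE⟩ := ih 0
      refine ⟨L, by simpa using hL, fun T h => ⟨(hT T h).1.trans (List.sublist_append_left _ _),
        (hT T h).2⟩, by rw [hz, hE]⟩
    | succ k =>
      obtain ⟨L, hL, hT, hE⟩ := ih (k + 1)
      obtain ⟨L', hL', hT', hE'⟩ := ih k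
      refine ⟨L ++ L'.map (· ++ [i]), ?_, ?_, ?_⟩
      · simp [hL, hL', Nat.choose_succ_succ, add_comm]
      · intro T hTL
        rcases List.mem_append.1 hTL with h | h
        · exact ⟨(hT T h).1.trans (List.sublist_append_left _ _), (hT T h).2⟩
        · obtain ⟨T', h', rfl⟩ := List.mem_map.1 h
          exact ⟨(hT' T' h').1.append (List.Sublist.refl _), by simp [(hT' T' h').2]⟩
      · have hprod : (L'.map (slotProd m G ∘ (· ++ [i]))).sum
            = (L'.map (slotProd m G)).sum * twist m (embed m (· < ·) i (G k)) := by
          rw [← List.sum_map_mul_right]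
          refine congrArg _ (List.map_congr_left fun T h => ?_)
          rw [Function.comp, slotProd_append, (hT' T h).2]
        rw [hs, hE, hE', List.map_append, List.sum_append, List.map_map, hprod, mul_add,
          pow_succ, mul_neg_one]
        simp only [neg_mul, mul_assoc, sub_eq_add_neg]

theorem strace_list_sum {ι : Type} [Fintype ι] [DecidableEq ι] (m : ℕ)
    (L : List (Matrix (ι → Fin N) (ι → Fin N) R)) :
    strace m L.sum = (L.map (strace m)).sum := by
  induction L with
  | nil => simp [strace]
  | cons A L ih =>
    rw [List.sum_cons, List.map_cons, List.sum_cons, ← ih]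
    simp [strace, mul_add, Finset.sum_add_distrib]

variable [Algebra ℂ R]

theorem strace_recursion_mul_asymm (m : ℕ) (G : ℕ → Fin N → Fin N → R) (d : ℂ)
    (hd : ∑ c : Fin N, (-1 : R) ^ par m c = algebraMap ℂ R d)
    (E : List (Fin l) → ℕ → Matrix (Fin l → Fin N) (Fin l → Fin N) R)
    (h0 : ∀ k, E [] k = if k = 0 then 1 else 0)
    (hz : ∀ S i, E (S ++ [i]) 0 = E S 0)
    (hs : ∀ S i k, E (S ++ [i]) (k + 1)
      = E S (k + 1) - E S k * twist m (embed m (· < ·) i (G k))) (k : ℕ) :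
    (k ≤ l → strace m (E (List.finRange l) k * asymm R m N l)
      = ((-1 : ℂ) ^ k * (l.choose k * ∏ j ∈ Finset.Ico k l, (d - j) / (j + 1))) •
        strace m (slotProd m G (List.finRange k).reverse * asymm R m N k)) ∧
    (l < k → E (List.finRange l) k = 0) := by
  obtain ⟨L, hL, hT, hE⟩ := exists_sublists_of_recursion m G E h0 hz hs (List.finRange l) k
  rw [List.length_finRange] at hL
  constructor
  · intro hkl
    have hc : ((-1 : Matrix (Fin l → Fin N) (Fin l → Fin N) R)) ^ k = (-1 : ℂ) ^ k • 1 := by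
      rcases Nat.even_or_odd k with h | h <;> simp [h.neg_one_pow]
    rw [hE, hc, smul_mul_assoc, one_mul, smul_mul_assoc, strace_smul, mul_smul,
      ← List.sum_map_mul_right, strace_list_sum, List.map_map]
    have : ∀ T ∈ L, (strace m ∘ fun T => slotProd m G T * asymm R m N l) T
        = (∏ j ∈ Finset.Ico k l, ((d - j) / (j + 1) : ℂ)) •
        strace m (slotProd m G (List.finRange k).reverse * asymm R m N k) := fun T h =>
      strace_slotProd_eq m G d hd l hkl T ((List.nodup_finRange l).sublist (hT T h).1) (hT T h).2
    rw [List.map_congr_left this, List.map_const', List.sum_replicate, hL, mul_smul,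
      Nat.cast_smul_eq_nsmul]
  · intro hkl
    rw [Nat.choose_eq_zero_of_lt hkl, List.length_eq_zero_iff] at hL
    simp [hE, hL]

theorem choose_mul_prod_eq_zbinom (d : ℂ) {k l : ℕ} (hkl : k ≤ l) :
    l.choose k * ∏ j ∈ Finset.Ico k l, (d - j) / (j + 1) = zbinom (d - k) (l - k) := by
  obtain ⟨r, rfl⟩ := Nat.exists_eq_add_of_le hkl
  rw [Finset.prod_Ico_eq_prod_range, Nat.add_sub_cancel_left, Finset.prod_div_distrib, zbinom]
  have h1 : ∏ i ∈ Finset.range r, (((k + i : ℕ) : ℂ) + 1) = (k + 1).ascFactorial r := by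
    rw [Nat.ascFactorial_eq_prod_range]
    push_cast
    exact Finset.prod_congr rfl fun i _ => by ring
  have h2 := Nat.factorial_mul_ascFactorial k r
  rw [← Nat.add_choose_mul_factorial_mul_factorial k r] at h2
  have h3 : (k + 1).ascFactorial r = (k + r).choose k * r.factorial :=
    Nat.eq_of_mul_eq_mul_left k.factorial_pos (by rw [h2, Nat.choose_symm_add]; ring)
  have h4 : ((r.factorial : ℕ) : ℂ) ≠ 0 := by exact_mod_cast r.factorial_ne_zero
  have h5 : (((k + r).choose k : ℕ) : ℂ) ≠ 0 := by
    exact_mod_cast (Nat.choose_pos (Nat.le_add_right k r)).ne'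
  rw [h1, h3]
  push_cast
  simp only [sub_sub]
  field_simp

end Expansion

section Kronecker

variable {R : Type} [Ring R] {l N : ℕ}

theorem slotProd_mul_left (m : ℕ) (q : Fin N → Fin N → R) (G : ℕ → Fin N → Fin N → R)
    (hq : ∀ a b, par m a ≠ par m b → q a b = 0) (hc : ∀ a b x, q a b * x = x * q a b)
    (S : List (Fin l)) (hS : S.Nodup) :
    slotProd m (fun j a b => ∑ c, q a c * G j c b) S
      = (S.map fun v => embed m (· < ·) v q).prod * slotProd m G S := by
  have hcomm : ∀ (v : Fin l) (T : List (Fin l)), v ∉ T →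
      Commute (embed m (· < ·) v q) (slotProd m G T) := by
    intro v T hv
    refine Commute.list_prod_right _ _ fun y hy => ?_
    obtain ⟨x, hx, rfl⟩ := List.mem_map.1 hy
    have hne : x.1 ≠ v := fun e => hv (e ▸ List.fst_mem_of_mem_zipIdx hx)
    have h := congrArg (twist m) (embed_commute_of_even m hne q (G x.2) hq hc).eq
    rwa [(isEven_embed m v q hq).twist_mul, (isEven_embed m v q hq).mul_twist] at h
  induction S using List.reverseRecOn with
  | nil => simp [slotProd_nil]
  | append_singleton S i ih =>
    have hn := List.nodup_append.1 hS
    have hi : i ∉ S := fun h => hn.2.2 i h i (List.mem_singleton_self i) rfl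
    rw [slotProd_append, slotProd_append, ih hn.1, ← embed_mul_embed_of_even m i q _ hq,
      (isEven_embed m i q hq).twist_mul, List.map_append, List.prod_append, mul_assoc, mul_assoc,
      ← mul_assoc (slotProd m G S), ← (hcomm i S hi).eq]
    simp [mul_assoc]

variable [Algebra ℂ R]

theorem prod_map_embed_apply (m : ℕ) (Q : Matrix (Fin N) (Fin N) ℂ)
    (hQ : ∀ a b, par m a ≠ par m b → Q a b = 0) (S : List (Fin l)) (hS : S.Nodup)
    (r s : Fin l → Fin N) :
    (S.map fun v => embed m (· < ·) v fun a b => algebraMap ℂ R (Q a b)).prod r s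
      = if ∀ w, w ∉ S → r w = s w then
          algebraMap ℂ R (S.map fun w => Q (r w) (s w)).prod else 0 := by
  induction S generalizing r with
  | nil => simp [Matrix.one_apply, funext_iff]
  | cons v S ih =>
    have hn := List.nodup_cons.1 hS
    have hQ' : ∀ a b, par m a ≠ par m b → algebraMap ℂ R (Q a b) = 0 := fun a b h => by
      rw [hQ a b h, map_zero]
    rw [List.map_cons, List.prod_cons, Matrix.mul_apply]
    simp only [embed_apply_of_even m v _ hQ', ite_mul, zero_mul, sum_eq_off, ih hn.2]
    have hiff : ∀ c, (∀ w, w ∉ S → Function.update r v c w = s w)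
        ↔ c = s v ∧ ∀ w, w ∉ v :: S → r w = s w := by
      intro c
      constructor
      · intro h
        refine ⟨by simpa using h v hn.1, fun w hw => ?_⟩
        rw [List.mem_cons, not_or] at hw
        simpa [hw.1] using h w hw.2
      · rintro ⟨rfl, h⟩ w hw
        by_cases hwv : w = v
        · subst hwv; simp
        · simpa [hwv] using h w (by simp [hwv, hw])
    have hmap : ∀ c, (S.map fun w => Q (Function.update r v c w) (s w))
        = S.map fun w => Q (r w) (s w) := fun c => List.map_congr_left fun w hw => by
      rw [Function.update_of_ne]
      rintro rfl
      exact hn.1 hw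
    simp only [hiff, hmap, ite_and, mul_ite, mul_zero, Finset.sum_ite_eq', Finset.mem_univ,
      if_true, Function.update_self, List.map_cons, List.prod_cons, map_mul]

theorem prod_map_embed_reverse_finRange (m k : ℕ) (Q : Matrix (Fin N) (Fin N) ℂ)
    (hQ : ∀ a b, par m a ≠ par m b → Q a b = 0) :
    ((List.finRange k).reverse.map fun v =>
      embed m (· < ·) v fun a b => algebraMap ℂ R (Q a b)).prod
      = (kron (ι := Fin k) Q).map (algebraMap ℂ R) := by
  ext r s
  rw [prod_map_embed_apply m Q hQ _ (List.nodup_reverse.2 (List.nodup_finRange k))]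
  simp only [List.mem_reverse, List.mem_finRange, not_true_eq_false, false_imp_iff, implies_true,
    if_true, Matrix.map_apply, kron, List.map_reverse, List.prod_reverse]
  rw [← List.ofFn_eq_map, List.prod_ofFn]

theorem isEven_kron (m k : ℕ) (Q : Matrix (Fin N) (Fin N) ℂ)
    (hQ : ∀ a b, par m a ≠ par m b → Q a b = 0) :
    IsEven m ((kron (ι := Fin k) Q).map (algebraMap ℂ R)) := by
  intro r s h
  rw [Matrix.map_apply, kron]
  obtain ⟨v, hv⟩ : ∃ v, par m (r v) ≠ par m (s v) := by
    by_contra! hall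
    exact h (Finset.sum_congr rfl fun v _ => hall v)
  rw [Finset.prod_eq_zero (Finset.mem_univ v) (hQ _ _ hv), map_zero]

/-- The supertrace of the ordered product with `Q` inserted in every slot, when the product without
`Q` is the twist of a given matrix `X`. -/
theorem strace_slotProd_reverse_finRange (m k : ℕ) (Q : Matrix (Fin N) (Fin N) ℂ)
    (hQ : ∀ a b, par m a ≠ par m b → Q a b = 0) (G : ℕ → Fin N → Fin N → R)
    (X : Matrix (Fin k → Fin N) (Fin k → Fin N) R)
    (hX : twist m X = slotProd m G (List.finRange k).reverse) :
    strace m (slotProd m (fun j a b => ∑ c, algebraMap ℂ R (Q a c) * G j c b)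
        (List.finRange k).reverse * asymm R m N k)
      = strace m (sMul m (asymm R m N k)
          (sMul m ((kron (ι := Fin k) Q).map (algebraMap ℂ R)) X)) := by
  rw [slotProd_mul_left m (fun a b => algebraMap ℂ R (Q a b)) G
    (fun a b h => by rw [hQ a b h, map_zero]) (fun a b x => Algebra.commutes _ _) _
    (List.nodup_reverse.2 (List.nodup_finRange k)), prod_map_embed_reverse_finRange m k Q hQ,
    ← (isEven_asymm m k).strace_mul_comm (asymm_commute m k), ← hX,
    ← (isEven_kron m k Q hQ).twist_eq, ← twist_sMul, ← (isEven_asymm m k).twist_eq,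
    ← twist_sMul, strace_twist]
  rw [(isEven_asymm m k).twist_eq, (isEven_kron m k Q hQ).twist_eq]

end Kronecker

section Series

variable {R : Type} [Ring R] {ι : Type} {N : ℕ}

/-- The matrix of power series with prescribed coefficient matrices. -/
def mkM (F : ℕ → Matrix (ι → Fin N) (ι → Fin N) R) :
    Matrix (ι → Fin N) (ι → Fin N) (PowerSeries R) :=
  fun r s => PowerSeries.mk fun p => F p r s

theorem coeff_neg_one_pow_mul (p a : ℕ) (x : PowerSeries R) :
    PowerSeries.coeff p ((-1) ^ a * x) = (-1) ^ a * PowerSeries.coeff p x := by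
  rcases Nat.even_or_odd a with h | h <;> simp [h.neg_one_pow]

variable [Fintype ι]

theorem twist_neg (m : ℕ) (A : Matrix (ι → Fin N) (ι → Fin N) R) :
    twist m (-A) = -twist m A := by
  ext r s
  simp [twist]

theorem twist_one [DecidableEq (ι → Fin N)] (m : ℕ) :
    twist m (1 : Matrix (ι → Fin N) (ι → Fin N) R) = 1 :=
  IsEven.twist_eq fun _ _ h => Matrix.one_apply_ne fun e => h (e ▸ rfl)

theorem mkM_serOne : mkM (serOne : ℕ → Matrix (ι → Fin N) (ι → Fin N) R) = 1 := by
  ext r s p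
  by_cases h : r = s <;> by_cases hp : p = 0 <;>
    simp [mkM, serOne, Matrix.one_apply, PowerSeries.coeff_one, h, hp]

variable [DecidableEq ι]

theorem coeff_strace_mkM (m p : ℕ) (F : ℕ → Matrix (ι → Fin N) (ι → Fin N) R) :
    PowerSeries.coeff p (strace m (mkM F)) = strace m (F p) := by
  simp [strace, mkM, map_sum, coeff_neg_one_pow_mul]

theorem mkM_serMul (m : ℕ) (F G : ℕ → Matrix (ι → Fin N) (ι → Fin N) R) :
    mkM (serMul m F G) = sMul m (mkM F) (mkM G) := by
  ext r t p
  simp only [mkM, serMul, sMul, PowerSeries.coeff_mk, map_sum, mul_assoc, coeff_neg_one_pow_mul,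
    Matrix.sum_apply]
  simp only [PowerSeries.coeff_mul, Finset.Nat.sum_antidiagonal_eq_sum_range_succ_mk,
    PowerSeries.coeff_mk, Finset.mul_sum]
  exact Finset.sum_comm

theorem twist_mkM_serProd (m : ℕ) (L : List (ℕ → Matrix (ι → Fin N) (ι → Fin N) R)) :
    twist m (mkM (serProd m L)) = (L.map fun F => twist m (mkM F)).prod := by
  induction L using List.reverseRecOn with
  | nil =>
    simp [serProd, mkM_serOne, twist_one]
  | append_singleton L F ih =>
    have : serProd m (L ++ [F]) = serMul m (serProd m L) F := by simp [serProd]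
    rw [this, mkM_serMul, twist_sMul, ih]
    simp

theorem mkM_embed (m : ℕ) (lt : ι → ι → Prop) [DecidableRel lt] (v : ι)
    (f : ℕ → Fin N → Fin N → R) :
    mkM (fun p => embed m lt v (f p))
      = embed m lt v fun a b => PowerSeries.mk fun p => f p a b := by
  ext r s p
  simp only [mkM, embed, PowerSeries.coeff_mk]
  split_ifs
  · rw [coeff_neg_one_pow_mul, PowerSeries.coeff_mk]
  · simp

variable [Algebra ℂ R]

theorem mkM_sMul_map_left (m : ℕ) (A : Matrix (ι → Fin N) (ι → Fin N) ℂ)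
    (F : ℕ → Matrix (ι → Fin N) (ι → Fin N) R) :
    mkM (fun p => sMul m (A.map (algebraMap ℂ R)) (F p))
      = sMul m (A.map (algebraMap ℂ (PowerSeries R))) (mkM F) := by
  ext r t p
  simp only [mkM, sMul, PowerSeries.coeff_mk, map_sum, mul_assoc, coeff_neg_one_pow_mul,
    Matrix.map_apply, PowerSeries.algebraMap_apply, PowerSeries.coeff_C_mul]

theorem mkM_sMul_map_right (m : ℕ) (A : Matrix (ι → Fin N) (ι → Fin N) ℂ)
    (F : ℕ → Matrix (ι → Fin N) (ι → Fin N) R) :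
    mkM (fun p => sMul m (F p) (A.map (algebraMap ℂ R)))
      = sMul m (mkM F) (A.map (algebraMap ℂ (PowerSeries R))) := by
  ext r t p
  simp only [mkM, sMul, PowerSeries.coeff_mk, map_sum, mul_assoc, coeff_neg_one_pow_mul,
    Matrix.map_apply, PowerSeries.algebraMap_apply, PowerSeries.coeff_mul_C]

theorem twist_mkM_dopMulM (m k : ℕ) (F G : ℕ → ℕ → Matrix (ι → Fin N) (ι → Fin N) R) :
    twist m (mkM (dopMulM m F G k))
      = ∑ i ∈ Finset.range (k + 1),
        twist m (mkM (F i)) * twist m (mkM (serShift (i : ℂ) (G (k - i)))) := by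
  simp only [← twist_sMul, ← mkM_serMul]
  ext r s p
  simp only [twist, mkM, dopMulM, Matrix.sum_apply, map_sum, coeff_neg_one_pow_mul,
    PowerSeries.coeff_mk, Finset.mul_sum]

theorem serShift_serOne (z : ℂ) :
    serShift z (serOne : ℕ → Matrix (ι → Fin N) (ι → Fin N) R) = serOne := by
  ext p r s
  rw [serShift, Finset.sum_eq_single 0]
  · cases p <;> simp [serOne, shiftCoeff]
  · intro q _ hq
    simp [serOne, hq]
  · simp

theorem serShift_zero (z : ℂ) :
    serShift z (fun _ => 0 : ℕ → Matrix (ι → Fin N) (ι → Fin N) R) = fun _ => 0 := by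
  ext p r s
  simp [serShift]

theorem serShift_neg_sMul (m : ℕ) (z : ℂ) (A : Matrix (ι → Fin N) (ι → Fin N) R)
    (F : ℕ → Matrix (ι → Fin N) (ι → Fin N) R) :
    serShift z (fun p => -sMul m A (F p)) = fun p => -sMul m A (serShift z F p) := by
  ext p r t
  simp only [serShift, sMul, Matrix.sum_apply, Matrix.smul_apply, Matrix.neg_apply, smul_neg,
    Finset.sum_neg_distrib, Finset.mul_sum, Finset.smul_sum, mul_smul_comm]
  rw [Finset.sum_comm]

theorem shiftCoeff_zero (p s : ℕ) (h : s ≤ p) : shiftCoeff 0 p s = if s = p then 1 else 0 := by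
  by_cases hs : s = p
  · simp [shiftCoeff, hs]
  · have : p - s ≠ 0 := by omega
    simp [shiftCoeff, hs, this]

end Series

section Transfer

variable (m n : ℕ)

/-- The matrix entry `T_{ab}(u - z)` as a power series in `u⁻¹`. -/
def shiftedT (z : ℂ) (a b : Fin (m + n)) : PowerSeries (Yangian m n) :=
  PowerSeries.mk fun p => ∑ s ∈ Finset.range (p + 1),
    algebraMap ℂ (Yangian m n) (shiftCoeff z p s) * TT m n a b s

theorem mkM_TfacY {l : ℕ} (i : Fin l) (z : ℂ) :
    mkM (TfacY m n (· < ·) i z) = embed m (· < ·) i (shiftedT m n z) :=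
  mkM_embed m (· < ·) i _

theorem serShift_TfacY_zero {l : ℕ} (i : Fin l) (z : ℂ) :
    serShift z (TfacY m n (· < ·) i 0) = TfacY m n (· < ·) i z := by
  have h0 : ∀ p a b, ∑ s ∈ Finset.range (p + 1),
      algebraMap ℂ (Yangian m n) (shiftCoeff 0 p s) * TT m n a b s = TT m n a b p := by
    intro p a b
    rw [Finset.sum_eq_single p]
    · simp [shiftCoeff_zero]
    · intro s hs hsp
      rw [shiftCoeff_zero _ _ (by simp at hs; omega), if_neg hsp]
      simp
    · simp
  ext p r s
  simp only [serShift, TfacY, h0, Matrix.sum_apply, Matrix.smul_apply, embed]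
  split_ifs
  · simp only [Finset.mul_sum, Algebra.smul_def]
    refine Finset.sum_congr rfl fun q _ => ?_
    rw [← mul_assoc, ← mul_assoc, Algebra.commutes]
  · simp

variable (Q : Matrix (Fin (m + n)) (Fin (m + n)) ℂ)

/-- The matrix entry `(Q T(u - z))_{ab}`. -/
def shiftedQT (z : ℂ) (a b : Fin (m + n)) : PowerSeries (Yangian m n) :=
  ∑ c, algebraMap ℂ (PowerSeries (Yangian m n)) (Q a c) * shiftedT m n z c b

/-- The `e^{-k∂_u}`-coefficient of the product of the factors of `𝒟_{l,Q}` over a list of slots. -/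
def dlCoeff (l : ℕ) (S : List (Fin l)) (k : ℕ) :
    Matrix (Fin l → Fin (m + n)) (Fin l → Fin (m + n)) (PowerSeries (Yangian m n)) :=
  twist m (mkM (((S.map (DlFactor m n l Q)).foldl (dopMulM m) dopOneM) k))

theorem dlCoeff_nil (l k : ℕ) : dlCoeff m n Q l [] k = if k = 0 then 1 else 0 := by
  by_cases hk : k = 0
  · subst hk
    have : (dopOneM 0 : ℕ → Matrix (Fin l → Fin (m + n)) (Fin l → Fin (m + n)) (Yangian m n))
        = serOne := by
      ext p
      simp [dopOneM, serOne]
    simp [dlCoeff, this, mkM_serOne, twist_one]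
  · ext r s p
    simp [dlCoeff, twist, mkM, dopOneM, hk, coeff_neg_one_pow_mul]

variable {Q}

theorem dlCoeff_append (l : ℕ) (S : List (Fin l)) (i : Fin l) (k : ℕ) :
    dlCoeff m n Q l (S ++ [i]) k = ∑ j ∈ Finset.range (k + 1), dlCoeff m n Q l S j *
      twist m (mkM (serShift (j : ℂ) (DlFactor m n l Q i (k - j)))) := by
  rw [dlCoeff, List.map_append, List.foldl_append]
  exact twist_mkM_dopMulM _ _ _ _

theorem dlCoeff_append_zero (l : ℕ) (S : List (Fin l)) (i : Fin l) :
    dlCoeff m n Q l (S ++ [i]) 0 = dlCoeff m n Q l S 0 := by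
  rw [dlCoeff_append]
  simp [DlFactor, serShift_serOne, mkM_serOne, twist_one]

theorem twist_mkM_serShift_DlFactor_one (hQ : ∀ a b, par m a ≠ par m b → Q a b = 0) (l : ℕ)
    (i : Fin l) (z : ℂ) :
    twist m (mkM (serShift z (DlFactor m n l Q i 1)))
      = -twist m (embed m (· < ·) i (shiftedQT m n Q z)) := by
  have hQ' : ∀ a b, par m a ≠ par m b →
      algebraMap ℂ (PowerSeries (Yangian m n)) (Q a b) = 0 := fun a b h => by
    rw [hQ a b h, map_zero]
  have hE : (embed m (· < ·) i fun a b => Q a b).map (algebraMap ℂ (PowerSeries (Yangian m n)))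
      = embed m (· < ·) i fun a b => algebraMap ℂ (PowerSeries (Yangian m n)) (Q a b) := by
    ext1 r s
    simp only [Matrix.map_apply, embed_apply_of_even m i _ hQ, embed_apply_of_even m i _ hQ',
      apply_ite (algebraMap ℂ (PowerSeries (Yangian m n))), map_zero]
  have hF : DlFactor m n l Q i 1 = fun p => -sMul m
      ((embed m (· < ·) i fun a b => Q a b).map (algebraMap ℂ (Yangian m n)))
      (TfacY m n (· < ·) i 0 p) := by
    simp [DlFactor]
  have hneg : ∀ F : ℕ → Matrix (Fin l → Fin (m + n)) (Fin l → Fin (m + n)) (Yangian m n),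
      mkM (fun p => -F p) = -mkM F := fun F => by ext; simp [mkM]
  rw [hF, serShift_neg_sMul, serShift_TfacY_zero, hneg, twist_neg, mkM_sMul_map_left, twist_sMul,
    hE, (isEven_embed m i _ hQ').twist_eq, ← (isEven_embed m i _ hQ').twist_mul, mkM_TfacY,
    embed_mul_embed_of_even m i _ _ hQ']
  rfl

theorem dlCoeff_append_succ (hQ : ∀ a b, par m a ≠ par m b → Q a b = 0) (l : ℕ) (S : List (Fin l))
    (i : Fin l) (k : ℕ) :
    dlCoeff m n Q l (S ++ [i]) (k + 1) = dlCoeff m n Q l S (k + 1)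
      - dlCoeff m n Q l S k * twist m (embed m (· < ·) i (shiftedQT m n Q k)) := by
  have h0 : DlFactor m n l Q i 0 = serOne := rfl
  rw [dlCoeff_append, Finset.sum_range_succ, Finset.sum_range_succ, Finset.sum_eq_zero, zero_add,
    Nat.sub_self, Nat.add_sub_cancel_left, twist_mkM_serShift_DlFactor_one m n hQ, h0,
    serShift_serOne, mkM_serOne, twist_one, mul_one, Matrix.mul_neg, ← sub_eq_neg_add]
  intro j hj
  have hj := Finset.mem_range.1 hj
  have h2 : DlFactor m n l Q i (k + 1 - j) = fun _ => 0 := by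
    rw [DlFactor, if_neg (by omega), if_neg (by omega)]
  have h3 : twist m (mkM fun _ => (0 : Matrix (Fin l → Fin (m + n)) (Fin l → Fin (m + n))
      (Yangian m n))) = 0 := by
    ext
    simp [twist, mkM, coeff_neg_one_pow_mul]
  rw [h2, serShift_zero, h3, mul_zero]

theorem sum_neg_one_pow_par :
    ∑ c : Fin (m + n), (-1 : PowerSeries (Yangian m n)) ^ par m c
      = algebraMap ℂ (PowerSeries (Yangian m n)) ((m : ℂ) - n) := by
  simp [Fin.sum_univ_add, par, parN, sub_eq_add_neg]

theorem twist_mkM_TwedgeProd (k : ℕ) :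
    twist m (mkM (TwedgeProd m n k))
      = slotProd m (fun j => shiftedT m n j) (List.finRange k).reverse := by
  rw [TwedgeProd, twist_mkM_serProd, slotProd, List.map_map]
  congr 1
  refine List.ext_getElem (by simp) fun j h1 h2 => ?_
  have hj : j < k := by simpa using h1
  simp only [List.getElem_map, List.getElem_zipIdx, List.getElem_reverse, List.getElem_finRange,
    Function.comp, mkM_TfacY, List.length_finRange]
  congr 3
  simp only [Fin.cast_mk]
  rw [Nat.sub_sub, Nat.cast_sub (by omega)]
  push_cast
  ring

theorem asymm_zero {R : Type} [Ring R] [Algebra ℂ R] (N : ℕ) : asymm R m N 0 = 1 := by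
  rw [asymm_eq, Fintype.sum_unique]
  have : (default : Equiv.Perm (Fin 0)) = 1 := rfl
  simp [this, permMat_one]

theorem coeff_strace_slotProd (hQ : ∀ a b, par m a ≠ par m b → Q a b = 0) (k p : ℕ) :
    PowerSeries.coeff p (strace m (slotProd m (fun j => shiftedQT m n Q j)
        (List.finRange k).reverse * asymm (PowerSeries (Yangian m n)) m (m + n) k))
      = transferT m n k Q p := by
  by_cases hk : k = 0
  · subst hk
    simp [slotProd_nil, asymm_zero, strace, transferT, mpar, PowerSeries.coeff_one]
  · have h := strace_slotProd_reverse_finRange m k Q hQ (fun j => shiftedT m n j) _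
      (twist_mkM_TwedgeProd m n k)
    rw [transferT, if_neg hk]
    refine (congrArg (PowerSeries.coeff p) h).trans ?_
    rw [← mkM_sMul_map_left, asymm, ← mkM_sMul_map_left, coeff_strace_mkM]

theorem DlQ_eq_coeff (l k p : ℕ) :
    DlQ m n l Q k p = PowerSeries.coeff p (strace m (dlCoeff m n Q l (List.finRange l) k *
      asymm (PowerSeries (Yangian m n)) m (m + n) l)) := by
  have h := twist_sMul m
    (mkM (((List.finRange l).map (DlFactor m n l Q)).foldl (dopMulM m) dopOneM k))
    (asymm (PowerSeries (Yangian m n)) m (m + n) l)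
  rw [(isEven_asymm m l).twist_eq] at h
  rw [dlCoeff, ← h, strace_twist, asymm, ← mkM_sMul_map_right, coeff_strace_mkM]
  rfl

end Transfer

theorem statement15 (m n l : ℕ) (hl : 1 ≤ l)
    (Q : Matrix (Fin (m + n)) (Fin (m + n)) ℂ) (hQeven : ∀ a b, par m a ≠ par m b → Q a b = 0) :
    (∀ k ≤ l, ∀ p : ℕ,
      DlQ m n l Q k p
        = ((-1 : ℂ) ^ k * zbinom ((m : ℂ) - (n : ℂ) - (k : ℕ)) (l - k)) • transferT m n k Q p)
    ∧ (∀ k : ℕ, l < k → ∀ p : ℕ, DlQ m n l Q k p = 0) := by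
  have h := fun k => strace_recursion_mul_asymm m (fun j => shiftedQT m n Q j) ((m : ℂ) - n)
    (sum_neg_one_pow_par m n) (dlCoeff m n Q l) (dlCoeff_nil m n Q l)
    (dlCoeff_append_zero m n l) (dlCoeff_append_succ m n hQeven l) k
  refine ⟨fun k hk p => ?_, fun k hk p => ?_⟩
  · rw [DlQ_eq_coeff, (h k).1 hk, choose_mul_prod_eq_zbinom _ hk, PowerSeries.coeff_smul,
      coeff_strace_slotProd m n hQeven]
  · rw [DlQ_eq_coeff, (h k).2 hk, zero_mul]
    simp [strace]

end Paper
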